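/- Assume f defines a quasihomogeneous isolated singularity and that 2·w_k ≤ d for all k. Let τ := N·d − 2(w₁+⋯+w_N) and h := hess(f) := det((∂²f/∂xᵢ∂xⱼ)_{i,j}). Then: (i) h ∉ J(f), i.e., the class of the Hessian in Jac(f) is nonzero; (ii) every weighted homogeneous p ∈ R of weighted degree strictly greater than τ lies in J(f); (iii) for every weighted homogeneous p ∈ R of weighted degree exactly τ there exists c ∈ ℂ with p − c·h ∈ J(f). In particular, the class of hess(f) spans the top-weight part of Jac(f), and any weighted homogeneous polynomial with nonzero class in Jac(f) has weighted degree at most τ, with equality only for scalar multiples of the class of hess(f). -/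

import Mathlib

open MvPolynomial

noncomputable section

/-- The Jacobian ideal of `f`. -/
def jacobianIdeal {N : ℕ} (f : MvPolynomial (Fin N) ℂ) :
    Ideal (MvPolynomial (Fin N) ℂ) :=
  Ideal.span (Set.range fun k : Fin N => pderiv k f)

/-- The Hessian polynomial of `f`. -/
def hess {N : ℕ} (f : MvPolynomial (Fin N) ℂ) : MvPolynomial (Fin N) ℂ :=
  Matrix.det (Matrix.of fun i j : Fin N => pderiv i (pderiv j f))

lemma aux_mem_iff {N : ℕ} (a : ℕ) (s : Set (Fin N)) (p : MvPolynomial (Fin N) ℂ) :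
    p ∈ Ideal.span ((fun k : Fin N => (X k : MvPolynomial (Fin N) ℂ) ^ a) '' s) ↔
      ∀ m ∈ p.support, ∃ k ∈ s, a ≤ m k := by
  have h := @mem_ideal_span_monomial_image (Fin N) ℂ _ p
    ((fun k : Fin N => Finsupp.single k a) '' s)
  rw [Set.image_image] at h
  simp only [X_pow_eq_monomial]
  rw [h]
  simp [Finsupp.single_le_iff]

lemma aux_X_mul {N : ℕ} (a : ℕ) (i : Fin N) (p : MvPolynomial (Fin N) ℂ)
    (h : X i * p ∈ Ideal.span ((fun k : Fin N => (X k : MvPolynomial (Fin N) ℂ) ^ a) '' {i}ᶜ)) :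
    p ∈ Ideal.span ((fun k : Fin N => (X k : MvPolynomial (Fin N) ℂ) ^ a) '' {i}ᶜ) := by
  rw [aux_mem_iff] at h ⊢
  intro m hm
  obtain ⟨k, hk, hak⟩ := h (Finsupp.single i 1 + m) (by
    rw [mem_support_iff] at hm ⊢
    rwa [mul_comm, add_comm, coeff_mul_X])
  refine ⟨k, hk, ?_⟩
  have hk' : i ≠ k := fun h => hk h.symm
  simpa [Finsupp.single_apply, hk'] using hak

lemma aux_cramer {N : ℕ} {A : Type*} [CommRing A] (E : Matrix (Fin N) (Fin N) A) (x : Fin N → A)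
    (I : Ideal A) (h : ∀ k, E.mulVec x k ∈ I) (j : Fin N) : E.det * x j ∈ I := by
  have h1 : E.adjugate.mulVec (E.mulVec x) = E.det • x := by
    rw [Matrix.mulVec_mulVec, Matrix.adjugate_mul, Matrix.smul_mulVec, Matrix.one_mulVec]
  have h2 := congrFun h1 j
  simp only [Pi.smul_apply, smul_eq_mul] at h2
  rw [← h2]
  change ∑ k, E.adjugate j k * E.mulVec x k ∈ I
  exact Ideal.sum_mem _ fun k _ => Ideal.mul_mem_left _ _ (h k)

lemma aux_det_congr {N : ℕ} (a : ℕ) (M D : Matrix (Fin N) (Fin N) (MvPolynomial (Fin N) ℂ))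
    (hM : ∀ k, M.mulVec X k = X k ^ a) (hD : ∀ k, D.mulVec X k = X k ^ a) :
    M.det - D.det ∈ Ideal.span
      (Set.range fun k : Fin N => (X k : MvPolynomial (Fin N) ℂ) ^ a) := by
  classical
  have key : ∀ s : Finset (Fin N),
      (Matrix.of fun k => if k ∈ s then M k else D k).det - D.det ∈ Ideal.span
        (Set.range fun k : Fin N => (X k : MvPolynomial (Fin N) ℂ) ^ a) := by
    intro s
    induction s using Finset.induction_on with
    | empty =>
      have : (Matrix.of fun k => if k ∈ (∅ : Finset (Fin N)) then M k else D k) = D := by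
        ext i j; simp
      rw [this]; simp
    | insert i s hi ih =>
      set E : Matrix (Fin N) (Fin N) (MvPolynomial (Fin N) ℂ) :=
        Matrix.of fun k => if k ∈ s then M k else D k with hE
      have hEx : ∀ k, E.mulVec X k = X k ^ a := by
        intro k
        have : E.mulVec X k = if k ∈ s then M.mulVec X k else D.mulVec X k := by
          simp only [hE, Matrix.mulVec, Matrix.of_apply]
          split_ifs <;> rfl
        rw [this, hM, hD, ite_self]
      have e1 : (Matrix.of fun k => if k ∈ insert i s then M k else D k) =
          E.updateRow i ((M i - D i) + D i) := by
        ext k j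
        by_cases hk : k = i
        · subst hk; simp
        · simp [hE, hk, Matrix.updateRow_ne]
      have e2 : E.updateRow i (D i) = E := by
        ext k j
        by_cases hk : k = i
        · subst hk; simp [hE, hi]
        · simp [hk, Matrix.updateRow_ne]
      rw [e1, Matrix.det_updateRow_add, e2, add_sub_assoc]
      refine Ideal.add_mem _ ?_ ih
      have h3 : (E.updateRow i (M i - D i)).det ∈
          Ideal.span ((fun k : Fin N => (X k : MvPolynomial (Fin N) ℂ) ^ a) '' {i}ᶜ) := by
        apply aux_X_mul
        rw [mul_comm]
        apply aux_cramer
        intro k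
        by_cases hk : k = i
        · subst hk
          have : (E.updateRow k (M k - D k)).mulVec X k = M.mulVec X k - D.mulVec X k := by
            simp [Matrix.mulVec, dotProduct, sub_mul]
          rw [this, hM, hD, sub_self]
          exact Ideal.zero_mem _
        · have : (E.updateRow i (M i - D i)).mulVec X k = E.mulVec X k := by
            simp [Matrix.mulVec, Matrix.updateRow_ne hk]
          rw [this, hEx]
          exact Ideal.subset_span ⟨k, hk, rfl⟩
      exact Ideal.span_mono (Set.image_subset_range _ _) h3
  have := key Finset.univ
  simp only [Finset.mem_univ, if_true] at this
  exact this

/-- The determinant of a transition matrix to the variables is not in the ideal. -/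
lemma aux_det_notMem {N : ℕ} (a : ℕ) (ha : 0 < a)
    (B : Matrix (Fin N) (Fin N) (MvPolynomial (Fin N) ℂ))
    (h : ∀ k, (X k : MvPolynomial (Fin N) ℂ) ^ a ∈ Ideal.span (Set.range (B.mulVec X))) :
    B.det ∉ Ideal.span (Set.range (B.mulVec X)) := by
  classical
  intro hB
  have h' : ∀ k, ∃ c : Fin N → MvPolynomial (Fin N) ℂ,
      ∑ i, c i * B.mulVec X i = (X k : MvPolynomial (Fin N) ℂ) ^ a := by
    intro k
    exact Ideal.mem_span_range_iff_exists_fun.mp (h k)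
  choose C hC using h'
  let Cm : Matrix (Fin N) (Fin N) (MvPolynomial (Fin N) ℂ) := Matrix.of C
  have hCB : ∀ k, (Cm * B).mulVec X k = X k ^ a := by
    intro k
    rw [← Matrix.mulVec_mulVec, ← hC k]
    rfl
  have h1 := aux_det_congr a (Cm * B) (Matrix.diagonal fun k => X k ^ (a - 1)) hCB (by
    intro k
    rw [Matrix.mulVec_diagonal, ← pow_succ, Nat.sub_add_cancel ha])
  set I := Ideal.span (Set.range fun k : Fin N => (X k : MvPolynomial (Fin N) ℂ) ^ a) with hI
  have h2 : (Cm * B).det ∈ I := by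
    rw [Matrix.det_mul]
    obtain ⟨c, hc⟩ := Ideal.mem_span_range_iff_exists_fun.mp hB
    rw [← hc, Finset.mul_sum]
    refine Ideal.sum_mem _ fun i _ => ?_
    rw [mul_left_comm]
    refine Ideal.mul_mem_left _ _ (aux_cramer Cm (B.mulVec X) I (fun k => ?_) i)
    rw [Matrix.mulVec_mulVec, hCB]
    exact Ideal.subset_span ⟨k, rfl⟩
  have h3 : (Matrix.diagonal fun k : Fin N => (X k : MvPolynomial (Fin N) ℂ) ^ (a - 1)).det ∈ I := by
    have := Ideal.sub_mem _ h2 h1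
    simpa using this
  rw [Matrix.det_diagonal, hI, ← Set.image_univ, aux_mem_iff] at h3
  have e : (∏ k : Fin N, (X k : MvPolynomial (Fin N) ℂ) ^ (a - 1)) =
      monomial (Finsupp.equivFunOnFinite.symm fun _ => a - 1) 1 := by
    rw [monomial_eq]
    simp [Finsupp.prod_fintype]
  obtain ⟨k, -, hk⟩ := h3 (Finsupp.equivFunOnFinite.symm fun _ => a - 1) (by
    rw [e]; simp [mem_support_iff])
  simp at hk
  omega

lemma wt_nonneg {N : ℕ} {w : Fin N → ℤ} (hw : ∀ k, 0 < w k) (s : Fin N →₀ ℕ) :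
    0 ≤ Finsupp.weight w s := by
  rw [Finsupp.weight_apply, Finsupp.sum_fintype _ _ (by simp)]
  exact Finset.sum_nonneg fun k _ => by
    have := (hw k).le
    positivity

lemma wt_eq_zero {N : ℕ} {w : Fin N → ℤ} (hw : ∀ k, 0 < w k) (s : Fin N →₀ ℕ)
    (h : Finsupp.weight w s = 0) : s = 0 := by
  rw [Finsupp.weight_apply, Finsupp.sum_fintype _ _ (by simp)] at h
  rw [Finset.sum_eq_zero_iff_of_nonneg (fun k _ => by
    have := (hw k).le
    positivity)] at h
  ext k
  have := h k (Finset.mem_univ k)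
  have hk := (hw k).ne'
  simpa [hk] using this

lemma wh_neg {N : ℕ} {w : Fin N → ℤ} (hw : ∀ k, 0 < w k) {p : MvPolynomial (Fin N) ℂ} {m : ℤ}
    (hp : p.IsWeightedHomogeneous w m) (hm : m < 0) : p = 0 := by
  ext s
  rw [coeff_zero]
  by_contra h
  have := hp h
  have := wt_nonneg hw s
  omega

lemma wh_zero {N : ℕ} {w : Fin N → ℤ} (hw : ∀ k, 0 < w k) {p : MvPolynomial (Fin N) ℂ}
    (hp : p.IsWeightedHomogeneous w 0) : p = C (constantCoeff p) := by
  ext s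
  rw [coeff_C]
  split_ifs with h
  · subst h; rfl
  · by_contra h'
    exact h (wt_eq_zero hw s (hp h')).symm

lemma wh_const {N : ℕ} {w : Fin N → ℤ} {p : MvPolynomial (Fin N) ℂ} {m : ℤ}
    (hp : p.IsWeightedHomogeneous w m) (hm : m ≠ 0) : constantCoeff p = 0 := by
  by_contra h
  exact hm (by simpa using (hp h).symm)

lemma wh_comp_mem {N : ℕ} {w : Fin N → ℤ} {g : Fin N → MvPolynomial (Fin N) ℂ} {D : Fin N → ℤ}
    (hg : ∀ i, (g i).IsWeightedHomogeneous w (D i)) {p : MvPolynomial (Fin N) ℂ}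
    (hp : p ∈ Ideal.span (Set.range g)) (m : ℤ) :
    weightedHomogeneousComponent w m p ∈ Ideal.span (Set.range g) := by
  let _ := weightedGradedAlgebra ℂ w
  refine weightedHomogeneousComponent_mem_of_mem ℂ w (Ideal.homogeneous_span _ _ ?_) hp m
  rintro _ ⟨i, rfl⟩
  exact ⟨D i, hg i⟩

lemma exists_pow {N : ℕ} {w : Fin N → ℤ} (hw : ∀ k, 0 < w k)
    {g : Fin N → MvPolynomial (Fin N) ℂ} {D : Fin N → ℤ}
    (hg : ∀ i, (g i).IsWeightedHomogeneous w (D i))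
    (hfin : FiniteDimensional ℂ (MvPolynomial (Fin N) ℂ ⧸ Ideal.span (Set.range g))) :
    ∃ a : ℕ, 0 < a ∧ ∀ k, (X k : MvPolynomial (Fin N) ℂ) ^ a ∈ Ideal.span (Set.range g) := by
  have h1 : ∀ k, ∃ a : ℕ, (X k : MvPolynomial (Fin N) ℂ) ^ a ∈ Ideal.span (Set.range g) := by
    intro k
    obtain ⟨q, hq, hq0⟩ := Algebra.IsIntegral.isIntegral (R := ℂ)
      (Ideal.Quotient.mk (Ideal.span (Set.range g)) (X k))
    rw [← Polynomial.aeval_def, ← Ideal.Quotient.mkₐ_eq_mk ℂ, Polynomial.aeval_algHom_apply,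
      Ideal.Quotient.mkₐ_eq_mk, Ideal.Quotient.eq_zero_iff_mem] at hq0
    have h2 := wh_comp_mem hg hq0 (q.natDegree • w k)
    refine ⟨q.natDegree, ?_⟩
    rw [Polynomial.aeval_eq_sum_range, map_sum, Finset.sum_eq_single q.natDegree] at h2
    · rw [map_smul, ((isWeightedHomogeneous_X ℂ w k).pow _).weightedHomogeneousComponent_same,
        Polynomial.coeff_natDegree, hq, one_smul] at h2
      exact h2
    · intro b _ hb
      rw [map_smul, ((isWeightedHomogeneous_X ℂ w k).pow b).weightedHomogeneousComponent_ne,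
        smul_zero]
      intro h
      have hk := (hw k).ne'
      simp [hk] at h
      omega
    · simp
  choose a ha using h1
  refine ⟨1 + ∑ k, a k, by omega, fun k => ?_⟩
  refine Ideal.mem_of_dvd _ (pow_dvd_pow _ ?_) (ha k)
  have := Finset.single_le_sum (f := a) (fun _ _ => Nat.zero_le _) (Finset.mem_univ k)
  omega

lemma euler {N : ℕ} {w : Fin N → ℤ} {p : MvPolynomial (Fin N) ℂ} {m : ℤ}
    (hp : p.IsWeightedHomogeneous w m) :
    ∑ i, C (w i : ℂ) * pderiv i p * X i = C (m : ℂ) * p := by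
  induction hp using IsWeightedHomogeneous.induction_on with
  | zero => simp
  | add p q hp hq h1 h2 =>
    simp only [map_add, mul_add, add_mul, Finset.sum_add_distrib, h1, h2]
  | monomial s r hr =>
    have : ∀ i, C (w i : ℂ) * pderiv i (monomial s r) * X i =
        C ((w i : ℂ) * (s i : ℂ)) * monomial s r := by
      intro i
      rw [mul_assoc, mul_comm _ (X i), X_mul_pderiv_monomial, nsmul_eq_mul, map_mul, mul_assoc]
      simp
    simp only [this]
    rw [← Finset.sum_mul, ← map_sum, ← hr, Finsupp.weight_apply, Finsupp.sum_fintype _ _ (by simp)]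
    congr 2
    push_cast
    exact Finset.sum_congr rfl fun i _ => by simp [mul_comm]

lemma graded_det {N : ℕ} {A : Type*} [CommRing A] [Algebra ℂ A] (𝒜 : ℤ → Submodule ℂ A)
    [SetLike.GradedMonoid 𝒜] (B : Matrix (Fin N) (Fin N) A) (u v : Fin N → ℤ)
    (h : ∀ i j, B i j ∈ 𝒜 (u i - v j)) : B.det ∈ 𝒜 (∑ i, u i - ∑ j, v j) := by
  rw [Matrix.det_apply]
  refine Submodule.sum_mem _ fun σ _ => ?_
  have h1 : ∏ i, B (σ i) i ∈ 𝒜 (∑ i, u i - ∑ j, v j) := by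
    have := SetLike.prod_mem_graded 𝒜 (F := Finset.univ) (fun i => u (σ i) - v i)
      (fun i => B (σ i) i) (fun i _ => h _ _)
    rwa [Finset.sum_sub_distrib, Equiv.sum_comp σ u] at this
  rcases Int.units_eq_one_or (Equiv.Perm.sign σ) with h | h <;> rw [h]
  · simpa using h1
  · simpa using h1

open scoped TensorProduct

/-- Bigraded pieces of total degree `n`. -/
def WW {N : ℕ} (w : Fin N → ℤ) (n : ℤ) :
    Submodule ℂ (MvPolynomial (Fin N) ℂ ⊗[ℂ] MvPolynomial (Fin N) ℂ) :=
  Submodule.span ℂ {z | ∃ (a b : MvPolynomial (Fin N) ℂ) (i j : ℤ),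
    a.IsWeightedHomogeneous w i ∧ b.IsWeightedHomogeneous w j ∧ i + j = n ∧ z = a ⊗ₜ[ℂ] b}

lemma WW_tmul {N : ℕ} {w : Fin N → ℤ} {a b : MvPolynomial (Fin N) ℂ} {i j n : ℤ}
    (ha : a.IsWeightedHomogeneous w i) (hb : b.IsWeightedHomogeneous w j) (h : i + j = n) :
    a ⊗ₜ[ℂ] b ∈ WW w n :=
  Submodule.subset_span ⟨a, b, i, j, ha, hb, h, rfl⟩

lemma WW_graded {N : ℕ} (w : Fin N → ℤ) : SetLike.GradedMonoid (WW w) where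
  one_mem := WW_tmul (isWeightedHomogeneous_one ℂ w) (isWeightedHomogeneous_one ℂ w) (add_zero 0)
  mul_mem := by
    intro m n x y hx hy
    have h : WW w m * WW w n ≤ WW w (m + n) := by
      rw [WW, WW, Submodule.span_mul_span, Submodule.span_le]
      rintro _ ⟨_, ⟨a, b, i, j, ha, hb, h, rfl⟩, _, ⟨a', b', i', j', ha', hb', h', rfl⟩, rfl⟩
      simp only [Algebra.TensorProduct.tmul_mul_tmul]
      exact WW_tmul (ha.mul ha') (hb.mul hb') (by omega)
    exact h (Submodule.mul_mem_mul hx hy)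

/-- The difference of a variable on both sides. -/
def xd {N : ℕ} (j : Fin N) : MvPolynomial (Fin N) ℂ ⊗[ℂ] MvPolynomial (Fin N) ℂ :=
  X j ⊗ₜ 1 - 1 ⊗ₜ X j

lemma exists_diff {N : ℕ} {w : Fin N → ℤ} {p : MvPolynomial (Fin N) ℂ} {m : ℤ}
    (hp : p.IsWeightedHomogeneous w m) :
    ∃ b : Fin N → MvPolynomial (Fin N) ℂ ⊗[ℂ] MvPolynomial (Fin N) ℂ,
      (∀ j, b j ∈ WW w (m - w j)) ∧ p ⊗ₜ[ℂ] 1 - 1 ⊗ₜ[ℂ] p = ∑ j, b j * xd j := by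
  classical
  induction hp using IsWeightedHomogeneous.induction_on with
  | zero => exact ⟨0, fun j => Submodule.zero_mem _, by simp⟩
  | add p q hp hq h1 h2 =>
    obtain ⟨b, hb, e⟩ := h1
    obtain ⟨b', hb', e'⟩ := h2
    refine ⟨b + b', fun j => Submodule.add_mem _ (hb j) (hb' j), ?_⟩
    simp only [Pi.add_apply, add_mul, Finset.sum_add_distrib, ← e, ← e', TensorProduct.add_tmul,
      TensorProduct.tmul_add]
    abel
  | monomial s r hr =>
    have key : ∀ n : ℕ, ∀ s : Fin N →₀ ℕ, s.degree = n → ∀ m : ℤ, Finsupp.weight w s = m →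
      ∃ b : Fin N → MvPolynomial (Fin N) ℂ ⊗[ℂ] MvPolynomial (Fin N) ℂ,
      (∀ j, b j ∈ WW w (m - w j)) ∧
      (monomial s r) ⊗ₜ[ℂ] 1 - 1 ⊗ₜ[ℂ] (monomial s r) = ∑ j, b j * xd j := by
      intro n
      induction n with
      | zero =>
        intro s hs m hm
        refine ⟨0, fun j => Submodule.zero_mem _, ?_⟩
        have : s = 0 := (Finsupp.degree_eq_zero_iff s).mp hs
        subst this
        have : monomial (0 : Fin N →₀ ℕ) r = r • (1 : MvPolynomial (Fin N) ℂ) := by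
          rw [smul_eq_C_mul, mul_one]; rfl
        rw [this]
        simp [TensorProduct.smul_tmul]
      | succ n ih =>
        intro s hs m hm
        have hs0 : s ≠ 0 := by rintro rfl; simp at hs
        obtain ⟨i, hi⟩ : ∃ i, s i ≠ 0 := by
          by_contra h
          push Not at h
          exact hs0 (Finsupp.ext h)
        obtain ⟨t, rfl⟩ : ∃ t, s = t + Finsupp.single i 1 :=
          ⟨s - Finsupp.single i 1, (tsub_add_cancel_of_le (by
            rw [Finsupp.single_le_iff]; omega)).symm⟩
        have hwt : Finsupp.weight w t = m - w i := by
          rw [← hm, map_add, Finsupp.weight_single]; simp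
        obtain ⟨b, hb, e⟩ := ih t (by simpa using hs) _ hwt
        refine ⟨fun j => (1 ⊗ₜ X i) * b j + Pi.single (M := fun _ => _) i
          (monomial t r ⊗ₜ[ℂ] (1 : MvPolynomial (Fin N) ℂ)) j, fun j => ?_, ?_⟩
        · refine Submodule.add_mem _ ?_ ?_
          · have := (WW_graded w).mul_mem (WW_tmul (isWeightedHomogeneous_one ℂ w)
              (isWeightedHomogeneous_X ℂ w i) rfl) (hb j)
            convert this using 2
            ring
          · by_cases hj : j = i
            · subst hj
              simp only [Pi.single_eq_same]
              exact WW_tmul (isWeightedHomogeneous_monomial w t r hwt)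
                (isWeightedHomogeneous_one ℂ w) (add_zero _)
            · simp only [Pi.single_eq_of_ne hj]
              exact Submodule.zero_mem _
        · simp only [add_mul, Finset.sum_add_distrib, mul_assoc, ← Finset.mul_sum, ← e]
          rw [Finset.sum_eq_single i]
          · simp only [Pi.single_eq_same, xd, mul_sub, Algebra.TensorProduct.tmul_mul_tmul, one_mul,
              mul_one]
            have : monomial (t + Finsupp.single i 1) r = X i * monomial t r := by
              rw [X, monomial_mul, one_mul, add_comm]
            rw [this, mul_comm (monomial t r)]
            abel
          · intro j _ hj
            simp [Pi.single_eq_of_ne hj]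
          · simp
    exact key _ s rfl _ hr

lemma diff_mem {N : ℕ} (p : MvPolynomial (Fin N) ℂ) :
    p ⊗ₜ[ℂ] 1 - 1 ⊗ₜ[ℂ] p ∈ Ideal.span (Set.range (xd (N := N))) := by
  induction p using MvPolynomial.induction_on with
  | C a =>
    have : (C a : MvPolynomial (Fin N) ℂ) = a • 1 := by rw [smul_eq_C_mul, mul_one]
    rw [this]
    simp [TensorProduct.smul_tmul]
  | add p q hp hq =>
    have := Ideal.add_mem _ hp hq
    convert this using 1
    simp only [TensorProduct.add_tmul, TensorProduct.tmul_add]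
    abel
  | mul_X p i hp =>
    have h1 := Ideal.mul_mem_left _ (1 ⊗ₜ X i) hp
    have h2 := Ideal.mul_mem_left (Ideal.span (Set.range (xd (N := N)))) (p ⊗ₜ 1)
      (Ideal.subset_span ⟨i, rfl⟩)
    have := Ideal.add_mem _ h1 h2
    convert this using 1
    simp only [xd, mul_sub, Algebra.TensorProduct.tmul_mul_tmul, one_mul, mul_one]
    rw [mul_comm (X i) p]
    abel

/-- Contraction with a functional in the left factor. -/
def TT {N : ℕ} (φ : MvPolynomial (Fin N) ℂ →ₗ[ℂ] ℂ) :
    MvPolynomial (Fin N) ℂ ⊗[ℂ] MvPolynomial (Fin N) ℂ →ₗ[ℂ] MvPolynomial (Fin N) ℂ :=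
  (TensorProduct.lid ℂ (MvPolynomial (Fin N) ℂ)).toLinearMap ∘ₗ φ.rTensor _

lemma TT_tmul {N : ℕ} (φ : MvPolynomial (Fin N) ℂ →ₗ[ℂ] ℂ) (a b : MvPolynomial (Fin N) ℂ) :
    TT φ (a ⊗ₜ b) = φ a • b := by
  simp [TT]

lemma TT_right {N : ℕ} (φ : MvPolynomial (Fin N) ℂ →ₗ[ℂ] ℂ) (p : MvPolynomial (Fin N) ℂ) (z) :
    TT φ ((1 ⊗ₜ p) * z) = p * TT φ z := by
  induction z using TensorProduct.induction_on with
  | zero => simp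
  | tmul a b => simp [TT_tmul]
  | add a b h1 h2 => simp only [mul_add, map_add, h1, h2]

lemma TT_left {N : ℕ} (φ : MvPolynomial (Fin N) ℂ →ₗ[ℂ] ℂ) (p : MvPolynomial (Fin N) ℂ) (z) :
    TT φ ((p ⊗ₜ 1) * z) = TT (φ ∘ₗ LinearMap.mulLeft ℂ p) z := by
  induction z using TensorProduct.induction_on with
  | zero => simp
  | tmul a b => simp [TT_tmul]
  | add a b h1 h2 => simp only [mul_add, map_add, h1, h2]

lemma TT_mem {N : ℕ} (J : Ideal (MvPolynomial (Fin N) ℂ)) (φ : MvPolynomial (Fin N) ℂ →ₗ[ℂ] ℂ)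
    (hφ : ∀ p ∈ J, φ p = 0) {q : MvPolynomial (Fin N) ℂ} (hq : q ∈ J) (z) :
    TT φ (z * (q ⊗ₜ 1 - 1 ⊗ₜ q)) ∈ J := by
  rw [mul_sub, mul_comm z, mul_comm z, map_sub, TT_left, TT_right]
  refine Ideal.sub_mem _ ?_ (Ideal.mul_mem_right _ _ hq)
  have : φ ∘ₗ LinearMap.mulLeft ℂ q = 0 := by
    ext1 s
    ext
    simpa using hφ _ (Ideal.mul_mem_right _ _ hq)
  rw [this]
  simp [TT]

/-- Setting the right variables to zero. -/
def EE (N : ℕ) : MvPolynomial (Fin N) ℂ ⊗[ℂ] MvPolynomial (Fin N) ℂ →ₐ[ℂ] MvPolynomial (Fin N) ℂ :=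
  Algebra.TensorProduct.productMap (AlgHom.id ℂ _)
    ((Algebra.ofId ℂ (MvPolynomial (Fin N) ℂ)).comp (aeval (fun _ => (0 : ℂ))))

lemma EE_tmul {N : ℕ} (a b : MvPolynomial (Fin N) ℂ) :
    EE N (a ⊗ₜ b) = constantCoeff b • a := by
  have : aeval (fun _ => (0 : ℂ)) b = constantCoeff b := by
    rw [show (fun _ : Fin N => (0 : ℂ)) = 0 from rfl, aeval_zero]; rfl
  rw [EE, Algebra.TensorProduct.productMap_apply_tmul, AlgHom.comp_apply, this, mul_comm,
    Algebra.ofId_apply, ← Algebra.smul_def, AlgHom.id_apply]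

lemma TT_const {N : ℕ} (φ : MvPolynomial (Fin N) ℂ →ₗ[ℂ] ℂ) (z) :
    constantCoeff (TT φ z) = φ (EE N z) := by
  induction z using TensorProduct.induction_on with
  | zero => simp
  | tmul a b =>
    simp [TT_tmul, EE_tmul, constantCoeff_smul, mul_comm]
  | add a b h1 h2 => simp only [map_add, h1, h2]

lemma EE_homog {N : ℕ} {w : Fin N → ℤ} {n : ℤ}
    {z} (hz : z ∈ WW w n) : (EE N z).IsWeightedHomogeneous w n := by
  rw [← mem_weightedHomogeneousSubmodule]
  induction hz using Submodule.span_induction with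
  | mem x h =>
    obtain ⟨a, b, i, j, ha, hb, h, rfl⟩ := h
    rw [EE_tmul]
    by_cases hj : j = 0
    · refine Submodule.smul_mem _ _ ?_
      rw [show n = i by omega]
      exact ha
    · rw [wh_const hb hj, zero_smul]
      exact Submodule.zero_mem _
  | zero => rw [map_zero]; exact Submodule.zero_mem _
  | add x y _ _ h1 h2 => rw [map_add]; exact Submodule.add_mem _ h1 h2
  | smul c x _ h => rw [map_smul]; exact Submodule.smul_mem _ _ h

lemma TT_homog {N : ℕ} {w : Fin N → ℤ} (φ : MvPolynomial (Fin N) ℂ →ₗ[ℂ] ℂ) (m n : ℤ)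
    (hφ : ∀ (p : MvPolynomial (Fin N) ℂ) (i : ℤ), p.IsWeightedHomogeneous w i → i ≠ m → φ p = 0)
    {z} (hz : z ∈ WW w n) : (TT φ z).IsWeightedHomogeneous w (n - m) := by
  rw [← mem_weightedHomogeneousSubmodule]
  induction hz using Submodule.span_induction with
  | mem x h =>
    obtain ⟨a, b, i, j, ha, hb, h, rfl⟩ := h
    rw [TT_tmul]
    by_cases hi : i = m
    · refine Submodule.smul_mem _ _ ?_
      rw [show n - m = j by omega]
      exact hb
    · rw [hφ a i ha hi, zero_smul]
      exact Submodule.zero_mem _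
  | zero => rw [map_zero]; exact Submodule.zero_mem _
  | add x y _ _ h1 h2 => rw [map_add]; exact Submodule.add_mem _ h1 h2
  | smul c x _ h => rw [map_smul]; exact Submodule.smul_mem _ _ h

theorem core {N : ℕ} {w : Fin N → ℤ} (hw : ∀ k, 0 < w k)
    {g : Fin N → MvPolynomial (Fin N) ℂ} {D : Fin N → ℤ}
    (hg : ∀ i, (g i).IsWeightedHomogeneous w (D i)) (hD : ∀ i, 0 < D i)
    (hfin : FiniteDimensional ℂ (MvPolynomial (Fin N) ℂ ⧸ Ideal.span (Set.range g))) :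
    ∃ q : MvPolynomial (Fin N) ℂ,
      (∀ (p : MvPolynomial (Fin N) ℂ) (m : ℤ), p.IsWeightedHomogeneous w m →
        ∑ i, D i - ∑ k, w k < m → p ∈ Ideal.span (Set.range g)) ∧
      (∀ p : MvPolynomial (Fin N) ℂ, p.IsWeightedHomogeneous w (∑ i, D i - ∑ k, w k) →
        ∃ c : ℂ, p - c • q ∈ Ideal.span (Set.range g)) := by
  classical
  set J := Ideal.span (Set.range g) with hJ
  set σ := ∑ i, D i - ∑ k, w k with hσ
  choose b hb hbe using fun i => exists_diff (hg i)
  let B : Matrix (Fin N) (Fin N) (MvPolynomial (Fin N) ℂ ⊗[ℂ] MvPolynomial (Fin N) ℂ) :=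
    Matrix.of b
  set Δ := B.det with hΔdef
  have hΔ : Δ ∈ WW w σ := by
    have := WW_graded w
    exact graded_det (WW w) B D w hb
  let q := EE N Δ
  have hq : q.IsWeightedHomogeneous w σ := EE_homog hΔ
  -- `q` is not in `J`
  have hqJ : q ∉ J := by
    have e1 : q = (B.map (EE N)).det := by
      rw [show q = EE N B.det from rfl, AlgHom.map_det]; rfl
    have e2 : (B.map (EE N)).mulVec X = g := by
      funext i
      have := congrArg (EE N) (hbe i)
      rw [map_sub, map_sum, EE_tmul, EE_tmul, wh_const (hg i) (hD i).ne'] at this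
      simp only [map_one, one_smul, zero_smul, sub_zero] at this
      rw [this]
      simp only [Matrix.mulVec, dotProduct]
      refine Finset.sum_congr rfl fun j _ => ?_
      rw [map_mul]
      congr 1
      simp [xd, EE_tmul]
    obtain ⟨a, ha, hX⟩ := exists_pow hw hg hfin
    have := aux_det_notMem a ha (B.map (EE N)) (by rw [e2]; exact hX)
    rwa [e2, ← e1] at this
  let mkL : MvPolynomial (Fin N) ℂ →ₗ[ℂ] MvPolynomial (Fin N) ℂ ⧸ J :=
    (Ideal.Quotient.mkₐ ℂ J).toLinearMap
  have hmk0 : ∀ p, mkL p = 0 ↔ p ∈ J := fun p => Ideal.Quotient.eq_zero_iff_mem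
  let Φ : Module.Dual ℂ (MvPolynomial (Fin N) ℂ ⧸ J) →ₗ[ℂ] MvPolynomial (Fin N) ℂ ⧸ J :=
    { toFun := fun φ => mkL (TT (φ ∘ₗ mkL) Δ)
      map_add' := fun φ ψ => by
        rw [LinearMap.add_comp, TT, LinearMap.rTensor_add, LinearMap.comp_add, LinearMap.add_apply,
          map_add]; rfl
      map_smul' := fun c φ => by
        rw [LinearMap.smul_comp, TT, LinearMap.rTensor_smul, LinearMap.comp_smul,
          LinearMap.smul_apply, map_smul]; rfl }
  have hΦ : ∀ φ, Φ φ = mkL (TT (φ ∘ₗ mkL) Δ) := fun φ => rfl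
  -- `Δ` is balanced
  have hbal : ∀ (φ : Module.Dual ℂ (MvPolynomial (Fin N) ℂ ⧸ J)) (p : MvPolynomial (Fin N) ℂ),
      TT (φ ∘ₗ mkL) (Δ * (p ⊗ₜ 1 - 1 ⊗ₜ p)) ∈ J := by
    intro φ p
    have hφ : ∀ p ∈ J, (φ ∘ₗ mkL) p = 0 := by
      intro p hp
      rw [LinearMap.comp_apply, (hmk0 p).mpr hp, map_zero]
    have h1 : Δ * (p ⊗ₜ 1 - 1 ⊗ₜ p) ∈ Ideal.span
        (Set.range fun i => (g i) ⊗ₜ[ℂ] (1 : MvPolynomial (Fin N) ℂ) - 1 ⊗ₜ[ℂ] (g i)) := by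
      obtain ⟨c, hc⟩ := Ideal.mem_span_range_iff_exists_fun.mp (diff_mem p)
      rw [← hc, Finset.mul_sum]
      refine Ideal.sum_mem _ fun j _ => ?_
      rw [mul_left_comm]
      refine Ideal.mul_mem_left _ _ (aux_cramer B xd _ (fun k => ?_) j)
      refine Ideal.subset_span ⟨k, ?_⟩
      exact hbe k
    obtain ⟨c, hc⟩ := Ideal.mem_span_range_iff_exists_fun.mp h1
    rw [← hc, map_sum]
    exact Ideal.sum_mem _ fun i _ => TT_mem J _ hφ (Ideal.subset_span ⟨i, rfl⟩) _
  -- homogeneous functionals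
  have hfun : ∀ (φ₀ : Module.Dual ℂ (MvPolynomial (Fin N) ℂ ⧸ J)) (m : ℤ),
      ∃ φ : Module.Dual ℂ (MvPolynomial (Fin N) ℂ ⧸ J),
        ∀ p, φ (mkL p) = φ₀ (mkL (weightedHomogeneousComponent w m p)) := by
    intro φ₀ m
    refine ⟨Submodule.liftQ (J.restrictScalars ℂ)
      (φ₀ ∘ₗ mkL ∘ₗ weightedHomogeneousComponent w m) ?_, fun p => rfl⟩
    intro p hp
    have := wh_comp_mem hg (p := p) hp m
    rw [LinearMap.mem_ker, LinearMap.comp_apply, LinearMap.comp_apply, (hmk0 _).mpr this, map_zero]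
  have hTh : ∀ (φ φ₀ : Module.Dual ℂ (MvPolynomial (Fin N) ℂ ⧸ J)) (m : ℤ),
      (∀ p, φ (mkL p) = φ₀ (mkL (weightedHomogeneousComponent w m p))) →
      (TT (φ ∘ₗ mkL) Δ).IsWeightedHomogeneous w (σ - m) := by
    intro φ φ₀ m h
    refine TT_homog _ m σ (fun p i hp hi => ?_) hΔ
    rw [LinearMap.comp_apply, h, hp.weightedHomogeneousComponent_ne _ hi.symm, map_zero, map_zero]
  have hTσ : ∀ (φ φ₀ : Module.Dual ℂ (MvPolynomial (Fin N) ℂ ⧸ J)),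
      (∀ p, φ (mkL p) = φ₀ (mkL (weightedHomogeneousComponent w σ p))) →
      TT (φ ∘ₗ mkL) Δ = C (φ₀ (mkL q)) := by
    intro φ φ₀ h
    have h1 := hTh φ φ₀ σ h
    rw [sub_self] at h1
    rw [wh_zero hw h1, TT_const, LinearMap.comp_apply, h]
    rw [show EE N Δ = q from rfl, hq.weightedHomogeneousComponent_same]
  -- surjectivity
  have hsurj : Function.Surjective Φ := by
    have hne : mkL q ≠ 0 := fun h => hqJ ((hmk0 q).mp h)
    obtain ⟨φ₁, hφ₁⟩ : ∃ φ₁ : Module.Dual ℂ (MvPolynomial (Fin N) ℂ ⧸ J), φ₁ (mkL q) ≠ 0 := by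
      by_contra h
      push Not at h
      exact hne ((Module.forall_dual_apply_eq_zero_iff ℂ _).mp h)
    obtain ⟨φ, hφ⟩ := hfun ((φ₁ (mkL q))⁻¹ • φ₁) σ
    have h1 := hTσ _ _ hφ
    rw [LinearMap.smul_apply, smul_eq_mul, inv_mul_cancel₀ hφ₁, C_1] at h1
    intro y
    obtain ⟨p, rfl⟩ := Ideal.Quotient.mk_surjective y
    refine ⟨φ ∘ₗ LinearMap.mulLeft ℂ (Ideal.Quotient.mk J p), ?_⟩
    have h2 := hbal φ p
    rw [mul_sub, mul_comm Δ, mul_comm Δ, map_sub, TT_left, TT_right, h1, mul_one] at h2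
    exact Ideal.Quotient.eq.mpr h2
  have hinj : Function.Injective Φ :=
    (LinearMap.injective_iff_surjective_of_finrank_eq_finrank
      Subspace.dual_finrank_eq).mpr hsurj
  have hker : ∀ φ, Φ φ = 0 → φ = 0 := fun φ h => hinj (by rw [h, map_zero])
  refine ⟨q, ?_, ?_⟩
  · intro p m hp hm
    rw [← hmk0]
    refine (Module.forall_dual_apply_eq_zero_iff ℂ _).mp fun φ₀ => ?_
    obtain ⟨φ, hφ⟩ := hfun φ₀ m
    have h0 : φ = 0 := by
      apply hker
      rw [hΦ, wh_neg hw (hTh φ φ₀ m hφ) (by omega), map_zero]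
    have := hφ p
    rw [hp.weightedHomogeneousComponent_same, h0] at this
    exact this.symm
  · intro p hp
    have hmem : mkL p ∈ Submodule.span ℂ {mkL q} := by
      by_contra hn
      obtain ⟨φ₀, h1, h2⟩ := Submodule.exists_le_ker_of_notMem hn
      obtain ⟨φ, hφ⟩ := hfun φ₀ σ
      have h3 : φ₀ (mkL q) = 0 := h2 (Submodule.mem_span_singleton_self _)
      have h0 : φ = 0 := by
        apply hker
        rw [hΦ, hTσ φ φ₀ hφ, h3, C_0, map_zero]
      have := hφ p
      rw [hp.weightedHomogeneousComponent_same, h0] at this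
      exact h1 this.symm
    obtain ⟨c, hc⟩ := Submodule.mem_span_singleton.mp hmem
    refine ⟨c, ?_⟩
    rw [← hmk0, map_sub, map_smul, hc, sub_self]

/-- Let `f` define a quasihomogeneous isolated singularity with `2w_k ≤ d` for all `k`,
and let `τ = N·d − 2(w₁+⋯+w_N)`. Then: (i) the class of `hess(f)` in `Jac(f)` is nonzero;
(ii) every weighted homogeneous polynomial of weighted degree `> τ` lies in `J(f)`;
(iii) every weighted homogeneous polynomial of weighted degree `τ` is, modulo `J(f)`,
a scalar multiple of `hess(f)`. -/
theorem hessian_spans_top_degree (N : ℕ) (hN : 0 < N) (w : Fin N → ℤ) (hw : ∀ k, 0 < w k)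
    (d : ℤ) (hd : 0 < d) (hwd : ∀ k, 2 * w k ≤ d)
    (f : MvPolynomial (Fin N) ℂ) (hf : f.IsWeightedHomogeneous w d)
    (hiso : FiniteDimensional ℂ (MvPolynomial (Fin N) ℂ ⧸ jacobianIdeal f)) :
    hess f ∉ jacobianIdeal f ∧
    (∀ (p : MvPolynomial (Fin N) ℂ) (m : ℤ), p.IsWeightedHomogeneous w m →
      (N : ℤ) * d - 2 * ∑ k, w k < m → p ∈ jacobianIdeal f) ∧
    (∀ p : MvPolynomial (Fin N) ℂ,
      p.IsWeightedHomogeneous w ((N : ℤ) * d - 2 * ∑ k, w k) →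
      ∃ c : ℂ, p - c • hess f ∈ jacobianIdeal f) := by
  classical
  have hD : ∀ i, 0 < d - w i := fun i => by
    have := hw i
    have := hwd i
    omega
  have hg : ∀ i, (pderiv i f).IsWeightedHomogeneous w (d - w i) := fun i =>
    hf.pderiv (by ring)
  have hτ : ∑ i, (d - w i) - ∑ k, w k = (N : ℤ) * d - 2 * ∑ k, w k := by
    rw [Finset.sum_sub_distrib]
    simp
    ring
  have hhom : (hess f).IsWeightedHomogeneous w ((N : ℤ) * d - 2 * ∑ k, w k) := by
    have := WeightedHomogeneousSubmodule.gradedMonoid (R := ℂ) (w := w)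
    have h := graded_det (weightedHomogeneousSubmodule ℂ w)
      (Matrix.of fun i j : Fin N => pderiv i (pderiv j f)) (fun i => d - w i) w (fun i j =>
        (hg j).pderiv (by ring))
    rw [hτ] at h
    exact h
  have hhess : hess f ∉ jacobianIdeal f := by
    intro hmem
    let B : Matrix (Fin N) (Fin N) (MvPolynomial (Fin N) ℂ) :=
      (Matrix.diagonal fun i => C (w i : ℂ)) * Matrix.of fun i j : Fin N => pderiv i (pderiv j f)
    have hBx : B.transpose.mulVec X = fun i => C ((d - w i : ℤ) : ℂ) * pderiv i f := by
      funext i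
      rw [← euler (hg i)]
      simp [B, Matrix.mulVec, dotProduct, Matrix.transpose_apply, Matrix.diagonal_mul]
    have hJ : Ideal.span (Set.range (B.transpose.mulVec X)) = jacobianIdeal f := by
      rw [hBx]
      apply le_antisymm
      · rw [Ideal.span_le]
        rintro _ ⟨i, rfl⟩
        exact Ideal.mul_mem_left _ _ (Ideal.subset_span ⟨i, rfl⟩)
      · rw [jacobianIdeal, Ideal.span_le]
        rintro _ ⟨i, rfl⟩
        have h0 : ((d - w i : ℤ) : ℂ) ≠ 0 := by exact_mod_cast (hD i).ne'
        have h1 : pderiv i f = C (((d - w i : ℤ) : ℂ)⁻¹) * (C ((d - w i : ℤ) : ℂ) * pderiv i f) := by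
          rw [← mul_assoc, ← C_mul, inv_mul_cancel₀ h0, C_1, one_mul]
        change pderiv i f ∈ _
        rw [h1]
        exact Ideal.mul_mem_left _ _ (Ideal.subset_span ⟨i, rfl⟩)
    obtain ⟨a, ha, hX⟩ := exists_pow hw hg hiso
    have h2 := aux_det_notMem a ha B.transpose (by rw [hJ]; exact hX)
    rw [hJ, Matrix.det_transpose, Matrix.det_mul] at h2
    exact h2 (Ideal.mul_mem_left _ _ hmem)
  obtain ⟨q, h1, h2⟩ := core hw hg hD hiso
  rw [hτ] at h1 h2
  refine ⟨hhess, h1, fun p hp => ?_⟩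
  obtain ⟨c, hc⟩ := h2 p hp
  obtain ⟨c', hc'⟩ := h2 _ hhom
  have hc0 : c' ≠ 0 := by
    rintro rfl
    rw [zero_smul, sub_zero] at hc'
    exact hhess hc'
  refine ⟨c * c'⁻¹, ?_⟩
  have h3 := Ideal.sub_mem _ hc (Ideal.mul_mem_left _ (C (c * c'⁻¹)) hc')
  have e : p - (c * c'⁻¹) • hess f = p - c • q - C (c * c'⁻¹) * (hess f - c' • q) := by
    rw [mul_sub, ← smul_eq_C_mul, ← smul_eq_C_mul, smul_smul, mul_assoc, inv_mul_cancel₀ hc0,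
      mul_one]
    abel
  rw [e]
  exact h3
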